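/- (Family IV) In the dual bracket of the Galilei bialgebra ansatz, take a unit vector μ ∈ ℝ³ (‖μ‖ = 1) and real numbers L, X, θ, B, C, W with W ≠ 0, and set α = 0, β = 0, γ = 0, φ = 0, n = 0, v = 0, ρ = 0, σ = 0, λ_i = L μ_i, ξ_i = X μ_i, ω_{ij} = W(δ_{ij} − μ_i μ_j), χ_{ij} = B(μ_i μ_j − (1/3) δ_{ij}) + C ε_{ijk} μ_k. Then the resulting bracket satisfies the Jacobi identity, and hence defines a Lie algebra structure on the 10-dimensional space spanned by H̃, P̃_i, K̃_i, J̃_i. -/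

import Mathlib

/-- The Levi-Civita symbol on `{1,2,3}` (indexed by `Fin 3`). -/
def eps (i j k : Fin 3) : ℝ :=
  if (i, j, k) = (0, 1, 2) ∨ (i, j, k) = (1, 2, 0) ∨ (i, j, k) = (2, 0, 1) then 1
  else if (i, j, k) = (2, 1, 0) ∨ (i, j, k) = (1, 0, 2) ∨ (i, j, k) = (0, 2, 1) then -1
  else 0

/-- The Kronecker delta on `Fin 3`. -/
def kron (i j : Fin 3) : ℝ := if i = j then 1 else 0

/-- The 10-dimensional real vector space with basis `H̃, P̃_i, K̃_i, J̃_i`, an element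
being recorded by its coefficients `(h, p, k, j)` in this basis. -/
abbrev DualV : Type := ℝ × (Fin 3 → ℝ) × (Fin 3 → ℝ) × (Fin 3 → ℝ)

/-- The dual bracket of the Galilei bialgebra ansatz: the antisymmetric bilinear
bracket on the span of `H̃, P̃_i, K̃_i, J̃_i` determined by the structure constants
(with parameters `α, γ, φ, λ, ξ, n ∈ ℝ³`, `β, v, θ, ρ ∈ ℝ`, `σ, χ, ω ∈ M₃(ℝ)`):
`[H̃, J̃_k] = ε_{ikl} α_l J̃_i`;
`[H̃, P̃_k] = γ_k H̃ + (β δ_{ik} + ε_{ikl} α_l) P̃_i + ε_{ikl} φ_l J̃_i`;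
`[H̃, K̃_k] = (β δ_{ik} + ε_{ikl} α_l) K̃_i + ε_{ikl} γ_l J̃_i`;
`[K̃_k, J̃_l] = 2(n_k δ_{li} − n_i δ_{kl}) K̃_i + 2(ε_{ikn} ω_{ln} + ε_{iln} ω_{nk}) J̃_i`;
`[P̃_l, P̃_m] = (χ_{lm} − χ_{ml}) H̃ + 2 ε_{klm}(ρ δ_{ki} + (1/2)(σ_{ik} − σ_{nn} δ_{ik})) P̃_i`
`  + 2(v ε_{ilm} + (1/2)(φ_l δ_{im} − φ_m δ_{il})) K̃_i + 2(λ_l δ_{im} − λ_m δ_{il}) J̃_i`;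
`[P̃_k, K̃_l] = (2 ξ_n ε_{nkl} − θ δ_{kl}) H̃ + (2 ε_{nki} ω_{nl} − ω_{nn} ε_{lki}) P̃_i`
`  + (ρ ε_{kli} − ε_{lin} σ_{kn} − δ_{ki} γ_l) K̃_i + (ε_{ikn} χ_{nl} + ε_{iln} χ_{kn}) J̃_i`;
`[P̃_k, J̃_l] = (2 ω_{lk} − ω_{nn} δ_{lk}) H̃ + 2(n_k δ_{li} − n_i δ_{kl}) P̃_i`
`  − (β ε_{kli} + α_l δ_{ki}) K̃_i + (ε_{ikn} σ_{nl} + ε_{iln} σ_{kn}) J̃_i`;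
`[K̃_m, K̃_n] = 2 ε_{kmn} ω_{ki} K̃_i + 2(ξ_m δ_{ni} − ξ_n δ_{mi}) J̃_i`;
`[J̃_k, J̃_l] = 2(n_k δ_{li} − n_l δ_{ki}) J̃_i`. -/
noncomputable def dualBracket (α γv φv lam ξ nv : Fin 3 → ℝ) (β v θ ρ : ℝ)
    (σ χ ω : Fin 3 → Fin 3 → ℝ) (X Y : DualV) : DualV :=
  -- coefficients of `X` and `Y` on `H̃, P̃, K̃, J̃`
  let h : ℝ := X.1; let p := X.2.1; let κ := X.2.2.1; let j := X.2.2.2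
  let h' : ℝ := Y.1; let p' := Y.2.1; let κ' := Y.2.2.1; let j' := Y.2.2.2
  ( -- H̃ component
    (∑ k, (h * p' k - h' * p k) * γv k)
    + (∑ l, ∑ m, p l * p' m * (χ l m - χ m l))
    + (∑ k, ∑ l, (p k * κ' l - p' k * κ l) * (2 * (∑ n, ξ n * eps n k l) - θ * kron k l))
    + (∑ k, ∑ l, (p k * j' l - p' k * j l) * (2 * ω l k - (∑ n, ω n n) * kron l k)),
    -- P̃ component
    fun i =>
      (∑ k, (h * p' k - h' * p k) * (β * kron i k + ∑ l, eps i k l * α l))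
      + (∑ l, ∑ m, p l * p' m *
          (2 * ∑ k, eps k l m * (ρ * kron k i + (1/2) * (σ i k - (∑ n, σ n n) * kron i k))))
      + (∑ k, ∑ l, (p k * κ' l - p' k * κ l) *
          (2 * (∑ n, eps n k i * ω n l) - (∑ n, ω n n) * eps l k i))
      + (∑ k, ∑ l, (p k * j' l - p' k * j l) * (2 * (nv k * kron l i - nv i * kron k l))),
    -- K̃ component
    fun i =>
      (∑ k, (h * κ' k - h' * κ k) * (β * kron i k + ∑ l, eps i k l * α l))
      + (∑ k, ∑ l, (κ k * j' l - κ' k * j l) * (2 * (nv k * kron l i - nv i * kron k l)))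
      + (∑ l, ∑ m, p l * p' m *
          (2 * (v * eps i l m + (1/2) * (φv l * kron i m - φv m * kron i l))))
      + (∑ k, ∑ l, (p k * κ' l - p' k * κ l) *
          (ρ * eps k l i - (∑ n, eps l i n * σ k n) - kron k i * γv l))
      + (∑ k, ∑ l, (p k * j' l - p' k * j l) * (-(β * eps k l i + α l * kron k i)))
      + (∑ m, ∑ n, κ m * κ' n * (2 * ∑ k, eps k m n * ω k i)),
    -- J̃ component
    fun i =>
      (∑ k, (h * j' k - h' * j k) * (∑ l, eps i k l * α l))
      + (∑ k, (h * p' k - h' * p k) * (∑ l, eps i k l * φv l))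
      + (∑ k, (h * κ' k - h' * κ k) * (∑ l, eps i k l * γv l))
      + (∑ k, ∑ l, (κ k * j' l - κ' k * j l) *
          (2 * ∑ n, (eps i k n * ω l n + eps i l n * ω n k)))
      + (∑ l, ∑ m, p l * p' m * (2 * (lam l * kron i m - lam m * kron i l)))
      + (∑ k, ∑ l, (p k * κ' l - p' k * κ l) * (∑ n, (eps i k n * χ n l + eps i l n * χ k n)))
      + (∑ k, ∑ l, (p k * j' l - p' k * j l) * (∑ n, (eps i k n * σ n l + eps i l n * σ k n)))
      + (∑ m, ∑ n, κ m * κ' n * (2 * (ξ m * kron n i - ξ n * kron m i)))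
      + (∑ k, ∑ l, j k * j' l * (2 * (nv k * kron l i - nv l * kron k i))) )

/-- A bracket operation on `DualV` satisfies the Jacobi identity. -/
def JacobiHolds (br : DualV → DualV → DualV) : Prop :=
  ∀ X Y Z : DualV, br X (br Y Z) + br Z (br X Y) + br Y (br Z X) = 0

open Matrix in
/-- The Family IV bracket in vector notation, with `μ ⬝ᵥ x` and `μ ⨯₃ x` as the only
occurrences of `μ` besides the inner product of `ℝ³`. -/
noncomputable def familyIVBracket (μ : Fin 3 → ℝ) (L X θ B C W : ℝ) (x y : DualV) : DualV :=
  (2 * C * ((μ ⨯₃ x.2.1) ⬝ᵥ y.2.1)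
      + 2 * X * ((μ ⨯₃ x.2.1) ⬝ᵥ y.2.2.1 - (μ ⨯₃ y.2.1) ⬝ᵥ x.2.2.1)
      - θ * (x.2.1 ⬝ᵥ y.2.2.1 - y.2.1 ⬝ᵥ x.2.2.1)
      - 2 * W * ((μ ⬝ᵥ x.2.1) * (μ ⬝ᵥ y.2.2.2) - (μ ⬝ᵥ y.2.1) * (μ ⬝ᵥ x.2.2.2)),
    (2 * W * (μ ⬝ᵥ x.2.2.1)) • (μ ⨯₃ y.2.1) - (2 * W * (μ ⬝ᵥ y.2.2.1)) • (μ ⨯₃ x.2.1),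
    (2 * W * (μ ⬝ᵥ x.2.2.1)) • (μ ⨯₃ y.2.2.1) - (2 * W * (μ ⬝ᵥ y.2.2.1)) • (μ ⨯₃ x.2.2.1),
    (2 * W * (μ ⬝ᵥ x.2.2.1)) • (μ ⨯₃ y.2.2.2) - (2 * W * (μ ⬝ᵥ y.2.2.1)) • (μ ⨯₃ x.2.2.2)
      + (2 * W * (μ ⬝ᵥ y.2.2.2)) • (μ ⨯₃ x.2.2.1) - (2 * W * (μ ⬝ᵥ x.2.2.2)) • (μ ⨯₃ y.2.2.1)
      + (2 * L * (μ ⬝ᵥ x.2.1)) • y.2.1 - (2 * L * (μ ⬝ᵥ y.2.1)) • x.2.1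
      + (B * (μ ⬝ᵥ x.2.2.1)) • (μ ⨯₃ y.2.1) - (B * (μ ⬝ᵥ y.2.2.1)) • (μ ⨯₃ x.2.1)
      + (B * (μ ⬝ᵥ y.2.1)) • (μ ⨯₃ x.2.2.1) - (B * (μ ⬝ᵥ x.2.1)) • (μ ⨯₃ y.2.2.1)
      + (C * (μ ⬝ᵥ x.2.1)) • y.2.2.1 - (C * (μ ⬝ᵥ y.2.1)) • x.2.2.1
      + (C * (μ ⬝ᵥ x.2.2.1)) • y.2.1 - (C * (μ ⬝ᵥ y.2.2.1)) • x.2.1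
      + (2 * X * (μ ⬝ᵥ x.2.2.1)) • y.2.2.1 - (2 * X * (μ ⬝ᵥ y.2.2.1)) • x.2.2.1)

set_option maxHeartbeats 1000000 in
open Matrix in
theorem dualBracket_eq_familyIVBracket (μ : Fin 3 → ℝ) (hμ : ∑ i, μ i * μ i = 1)
    (L X θ B C W : ℝ) :
    dualBracket 0 0 0 (fun i => L * μ i) (fun i => X * μ i) 0 0 0 θ 0 0
      (fun i j => B * (μ i * μ j - (1/3) * kron i j) + C * ∑ k, eps i j k * μ k)
      (fun i j => W * (kron i j - μ i * μ j)) = familyIVBracket μ L X θ B C W := by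
  funext ⟨h, p, κ, j⟩ ⟨h', p', κ', j'⟩
  rw [Fin.sum_univ_three] at hμ
  refine Prod.ext ?_ (Prod.ext (funext fun i => ?_) (Prod.ext (funext fun i => ?_)
    (funext fun i => ?_)))
  all_goals
    simp only [dualBracket, familyIVBracket, Fin.sum_univ_three, vec3_dotProduct, cross_apply,
      Pi.zero_apply, Pi.add_apply, Pi.sub_apply, Pi.smul_apply, smul_eq_mul, mul_zero, zero_mul,
      add_zero, zero_add, sub_zero, neg_zero, cons_val_zero, cons_val_one, cons_val]
  · simp [eps, kron]
    linear_combination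
      (W * (p 0 * j' 0 + p 1 * j' 1 + p 2 * j' 2 - p' 0 * j 0 - p' 1 * j 1 - p' 2 * j 2)) * hμ
  · fin_cases i <;> simp [eps, kron]
    · linear_combination (W * (p 2 * κ' 1 - p 1 * κ' 2 + p' 1 * κ 2 - p' 2 * κ 1)) * hμ
    · linear_combination (W * (p 0 * κ' 2 - p 2 * κ' 0 + p' 2 * κ 0 - p' 0 * κ 2)) * hμ
    · linear_combination (W * (p 1 * κ' 0 - p 0 * κ' 1 + p' 0 * κ 1 - p' 1 * κ 0)) * hμ
  · fin_cases i <;> simp [eps, kron]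
    · linear_combination (-2 * W * (κ 1 * κ' 2 - κ 2 * κ' 1)) * hμ
    · linear_combination (-2 * W * (κ 2 * κ' 0 - κ 0 * κ' 2)) * hμ
    · linear_combination (-2 * W * (κ 0 * κ' 1 - κ 1 * κ' 0)) * hμ
  · fin_cases i <;> simp [eps, kron] <;> ring

open Matrix in
theorem cross_cross_self_of_unit {μ : Fin 3 → ℝ} (hμ : μ ⬝ᵥ μ = 1) (x : Fin 3 → ℝ) :
    μ ⨯₃ (μ ⨯₃ x) = (μ ⬝ᵥ x) • μ - x := by
  rw [cross_cross_eq_smul_sub_smul', hμ, one_smul]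

open Matrix in
theorem cross_dot_cross_of_unit {μ : Fin 3 → ℝ} (hμ : μ ⬝ᵥ μ = 1) (x y : Fin 3 → ℝ) :
    (μ ⨯₃ x) ⬝ᵥ (μ ⨯₃ y) = x ⬝ᵥ y - (μ ⬝ᵥ x) * (μ ⬝ᵥ y) := by
  rw [cross_dot_cross, hμ, one_mul, dotProduct_comm x μ, mul_comm]

open Matrix in
theorem jacobiHolds_familyIVBracket {μ : Fin 3 → ℝ} (hμ : μ ⬝ᵥ μ = 1) (L X θ B C W : ℝ) :
    JacobiHolds (familyIVBracket μ L X θ B C W) := by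
  rintro ⟨h, p, κ, j⟩ ⟨h', p', κ', j'⟩ ⟨h'', p'', κ'', j''⟩
  refine Prod.ext ?_ (Prod.ext ?_ (Prod.ext ?_ ?_))
  all_goals
    simp only [familyIVBracket, Prod.fst_add, Prod.snd_add, Prod.fst_zero, Prod.snd_zero,
      map_add, map_sub, map_smul, dotProduct_add, dotProduct_sub, dotProduct_smul,
      sub_dotProduct, smul_dotProduct, smul_eq_mul, dot_self_cross,
      cross_cross_self_of_unit hμ, cross_dot_cross_of_unit hμ]
  · simp only [vec3_dotProduct, cross_apply, cons_val_zero, cons_val_one, cons_val]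
    ring
  · module
  · module
  · module

/-- (Family IV) For a unit vector `μ ∈ ℝ³`, `W ≠ 0`, `λ = L μ`, `ξ = X μ`, arbitrary
`θ`, `ω_{ij} = W(δ_{ij} − μ_i μ_j)`, `χ_{ij} = B(μ_i μ_j − (1/3) δ_{ij}) + C ε_{ijk} μ_k`,
and all other parameters zero, the dual bracket of the Galilei bialgebra ansatz
satisfies the Jacobi identity, and hence defines a Lie algebra structure. -/
theorem familyIV_jacobi (μ : Fin 3 → ℝ) (hμ : ∑ i, μ i * μ i = 1)
    (L X θ B C W : ℝ) (hW : W ≠ 0) :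
    JacobiHolds (dualBracket 0 0 0 (fun i => L * μ i) (fun i => X * μ i) 0
      0 0 θ 0
      0
      (fun i j => B * (μ i * μ j - (1/3) * kron i j) + C * ∑ k, eps i j k * μ k)
      (fun i j => W * (kron i j - μ i * μ j))) := by
  rw [dualBracket_eq_familyIVBracket μ hμ]
  exact jacobiHolds_familyIVBracket
    (by simpa only [dotProduct] using hμ) L X θ B C W
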